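/- Let a, c ∈ ℂ and N ∈ ℕ. Assume a−c+1−ℓ+i ≠ 0 for all integers 0 ≤ ℓ ≤ N and 0 ≤ i ≤ N−1, that 2a+i ≠ 0 for all 0 ≤ i ≤ N−1, that 2a+N+i ≠ 0 for all 0 ≤ i ≤ N−1, and that 2a ≠ 1. For 0 ≤ k ≤ N and ℓ ∈ ℕ define the Hahn rational function value Uₖ(ℓ; a, c−1, N) = Σ_{j=0}^{k} [ (−k)ⱼ · (−ℓ)ⱼ · (k+2a−1)ⱼ ] / [ (a−c+1−ℓ)ⱼ · (−N)ⱼ · j! ]. Define aₖ(x) = (x+a)ₖ·(x+1−a−N)_{N−k} and bₗ(x) = (x+c)ₗ. Then for every 0 ≤ ℓ ≤ N and all x ∈ ℂ, bₗ(x) = (−1)^N · [ (c−a)ₗ / (2a)_N ] · Σ_{k=0}^{N} [ (1−2a−2k) / (1−2a) ] · [ (−N)ₖ · (2a−1)ₖ / ( k! · (2a+N)ₖ ) ] · Uₖ(ℓ; a, c−1, N) · aₖ(x). -/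

import Mathlib

/-- The Pochhammer symbol `(z)ₘ = z (z+1) ⋯ (z+m-1)`. -/
noncomputable def poch (z : ℂ) (m : ℕ) : ℂ := ∏ i ∈ Finset.range m, (z + i)

/-- The Hahn rational function
`Uₖ(ℓ; a, c', N) = Σ_{j=0}^{k} (-k)ⱼ (-ℓ)ⱼ (k+2a-1)ⱼ / ((a-c'-ℓ)ⱼ (-N)ⱼ j!)`. -/
noncomputable def hahnU (a c' : ℂ) (N k : ℕ) (l : ℂ) : ℂ :=
  ∑ j ∈ Finset.range (k + 1),
    (poch (-(k : ℂ)) j * poch (-l) j * poch ((k : ℂ) + 2 * a - 1) j) /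
      (poch (a - c' - l) j * poch (-(N : ℂ)) j * (Nat.factorial j : ℂ))

/-- The basis `aₖ(x) = (x+a)ₖ (x+1-a-N)_{N-k}`. -/
noncomputable def aFun (a : ℂ) (N k : ℕ) (x : ℂ) : ℂ :=
  poch (x + a) k * poch (x + 1 - a - N) (N - k)

/-- The basis `bₗ(x) = (x+c)ₗ`. -/
noncomputable def bFun (c : ℂ) (l : ℕ) (x : ℂ) : ℂ := poch (x + c) l

theorem poch_add (z : ℂ) (m n : ℕ) : poch z (m + n) = poch z m * poch (z + m) n := by
  simp only [poch, Finset.prod_range_add, Nat.cast_add, add_assoc]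

theorem poch_zero (z : ℂ) : poch z 0 = 1 := by simp [poch]

theorem poch_succ (z : ℂ) (m : ℕ) : poch z (m + 1) = poch z m * (z + m) := by
  simp only [poch, Finset.prod_range_succ]

theorem poch_succ' (z : ℂ) (m : ℕ) : poch z (m + 1) = z * poch (z + 1) m := by
  rw [add_comm, poch_add]
  simp [poch]

theorem poch_ne_zero {z : ℂ} {m : ℕ} (h : ∀ i < m, z + (i : ℂ) ≠ 0) : poch z m ≠ 0 :=
  Finset.prod_ne_zero_iff.mpr fun i hi => h i (Finset.mem_range.mp hi)

theorem poch_reflect (z : ℂ) (m : ℕ) : poch z m = (-1) ^ m * poch (1 - z - m) m := by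
  induction m generalizing z with
  | zero => simp [poch]
  | succ m ih =>
    rw [poch_succ', ih, poch_succ']
    have e : 1 - z - ((m + 1 : ℕ) : ℂ) + 1 = 1 - z - m := by push_cast; ring
    have e' : 1 - (z + 1) - (m : ℂ) = 1 - z - ((m + 1 : ℕ) : ℂ) := by push_cast; ring
    rw [e, e']
    have key := (poch_succ (1 - z - ((m + 1 : ℕ) : ℂ)) m).symm.trans (poch_succ' _ m)
    rw [e] at key
    rw [← key]
    push_cast
    ring

theorem poch_neg_natCast (n j : ℕ) :
    poch (-((n + j : ℕ) : ℂ)) j * (n.factorial : ℂ) = (-1) ^ j * ((n + j).factorial : ℂ) := by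
  induction j with
  | zero => simp [poch]
  | succ j ih =>
    have e : -((n + (j + 1) : ℕ) : ℂ) + 1 = -((n + j : ℕ) : ℂ) := by push_cast; ring
    rw [poch_succ', e, mul_assoc, ih, ← add_assoc, Nat.factorial_succ]
    push_cast
    ring

/-- The Chu–Vandermonde identity. -/
theorem sum_choose_mul_poch_mul_poch (p q : ℂ) (n : ℕ) :
    ∑ j ∈ Finset.range (n + 1), (n.choose j : ℂ) * (poch p j * poch q (n - j)) =
      poch (p + q) n := by
  induction n with
  | zero => simp [poch]
  | succ n ih =>
    have h := Finset.sum_antidiagonal_choose_succ_mul (fun i j => poch p i * poch q j) n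
    rw [Finset.Nat.sum_antidiagonal_eq_sum_range_succ_mk] at h
    rw [h, Finset.Nat.sum_antidiagonal_eq_sum_range_succ_mk,
      Finset.Nat.sum_antidiagonal_eq_sum_range_succ_mk, ← Finset.sum_add_distrib,
      poch_succ, ← ih, Finset.sum_mul]
    refine Finset.sum_congr rfl fun j hj => ?_
    obtain ⟨d, rfl⟩ := Nat.exists_eq_add_of_le (Nat.lt_succ_iff.mp (Finset.mem_range.mp hj))
    have e : (j + d).choose d = (j + d).choose j := Nat.choose_symm_add.symm
    simp only [Nat.add_sub_cancel_left, poch_succ, e]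
    push_cast
    ring

/-- The summand of the terminating very-well-poised `₄F₃(-1)` series, normalized to have sum `1`. -/
noncomputable def wellPoisedTerm (B D : ℂ) (N m : ℕ) : ℂ :=
  (N.choose m : ℂ) * (B + D - 1 + 2 * m) * poch B m * poch (D + m) (N - m) /
    poch (B + D - 1 + m) (N + 1)

/-- The Wilf–Zeilberger companion of `wellPoisedTerm`. -/
noncomputable def wellPoisedCompanion (B D : ℂ) (N m : ℕ) : ℂ :=
  (N.choose m : ℂ) * poch B (m + 1) * poch (D + m) (N - m) / poch (B + D + m) (N + 1)

theorem wellPoisedTerm_sub_zero (B D : ℂ) (N : ℕ)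
    (h : ∀ i ≤ N + 1, B + D - 1 + (i : ℂ) ≠ 0) :
    wellPoisedTerm B D (N + 1) 0 - wellPoisedTerm B D N 0 = -wellPoisedCompanion B D N 0 := by
  have h0 : B + D - 1 ≠ 0 := by simpa using h 0 (by omega)
  have h1 : B + D - 1 + ((N + 1 : ℕ) : ℂ) ≠ 0 := h (N + 1) le_rfl
  have hp : poch (B + D) N ≠ 0 := poch_ne_zero fun i hi => by
    convert h (i + 1) (by omega) using 1; push_cast; ring
  have e : B + D - 1 + 1 = B + D := by ring
  have h1' : B + D + (N : ℂ) ≠ 0 := by convert h1 using 1; push_cast; ring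
  simp only [wellPoisedTerm, wellPoisedCompanion, Nat.choose_zero_right, Nat.cast_zero, add_zero,
    mul_zero, Nat.sub_zero, poch_zero, poch_succ' (B + D - 1), poch_succ D, poch_succ (B + D), e,
    poch_succ B, Nat.cast_one]
  field_simp
  ring

theorem wellPoisedTerm_sub_succ (B D : ℂ) (M d : ℕ)
    (h : ∀ i ≤ 2 * (M + 1 + d + 1), B + D - 1 + (i : ℂ) ≠ 0) :
    wellPoisedTerm B D (M + 1 + d + 1) (M + 1) - wellPoisedTerm B D (M + 1 + d) (M + 1) =
      wellPoisedCompanion B D (M + 1 + d) M - wellPoisedCompanion B D (M + 1 + d) (M + 1) := by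
  have c1 : ((M + 1 + d + 1).choose (M + 1) : ℂ) =
      (M + 1 + d).choose M + (M + 1 + d).choose (M + 1) := by
    rw [Nat.choose_succ_succ]; push_cast; ring
  have c2 : ((M + 1 + d).choose (M + 1) : ℂ) * (M + 1) = (M + 1 + d).choose M * (d + 1) := by
    have := Nat.choose_succ_right_eq (M + 1 + d) M
    rw [show M + 1 + d - M = d + 1 by omega] at this
    exact_mod_cast this
  have s1 : M + 1 + d + 1 - (M + 1) = d + 1 := by omega
  have s2 : M + 1 + d - (M + 1) = d := by omega
  have s3 : M + 1 + d - M = d + 1 := by omega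
  have e1 : B + D - 1 + ((M + 1 : ℕ) : ℂ) = B + D + M := by push_cast; ring
  have e2 : B + D + ((M + 1 : ℕ) : ℂ) = B + D + M + 1 := by push_cast; ring
  have e3 : D + ((M + 1 : ℕ) : ℂ) = D + M + 1 := by push_cast; ring
  set n := M + 1 + d with hn
  have h0 : B + D + (M : ℂ) ≠ 0 := by
    convert h (M + 1) (by omega) using 1; push_cast; ring
  have h1 : B + D + (M : ℂ) + 1 + n ≠ 0 := by
    convert h (M + 2 + n) (by omega) using 1; push_cast; ring
  have hp : poch (B + D + M + 1) n ≠ 0 := poch_ne_zero fun i hi => by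
    convert h (M + 2 + i) (by omega) using 1; push_cast; ring
  have q1 : poch (B + D + M) (n + 1 + 1) =
      (B + D + M) * (poch (B + D + M + 1) n * (B + D + M + 1 + n)) := by
    rw [poch_succ', poch_succ]
  have q2 : poch (D + M) (d + 1) = (D + M) * poch (D + M + 1) d := poch_succ' _ _
  have hnc : (n : ℂ) = M + 1 + d := by rw [hn]; push_cast; ring
  simp only [wellPoisedTerm, wellPoisedCompanion, s1, s2, s3, e1, e2, e3, q1, q2, c1,
    poch_succ' (B + D + M) n, poch_succ (B + D + M + 1) n, poch_succ (D + M + 1) d,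
    poch_succ B (M + 1)]
  have c3 : ((n.choose M : ℕ) : ℂ) = n.choose (M + 1) * (M + 1) / (d + 1) := by
    have : (d : ℂ) + 1 ≠ 0 := Nat.cast_add_one_ne_zero d
    field_simp
    linear_combination -c2
  have hd : (d : ℂ) + 1 ≠ 0 := Nat.cast_add_one_ne_zero d
  rw [c3]
  rw [hnc] at h1 ⊢
  push_cast
  field_simp
  ring

theorem sum_wellPoisedTerm_sub (B D : ℂ) (N M : ℕ) (hM : M ≤ N)
    (h : ∀ i ≤ 2 * (N + 1), B + D - 1 + (i : ℂ) ≠ 0) :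
    ∑ m ∈ Finset.range (M + 1), (wellPoisedTerm B D (N + 1) m - wellPoisedTerm B D N m) =
      -wellPoisedCompanion B D N M := by
  induction M with
  | zero => simpa using wellPoisedTerm_sub_zero B D N fun i hi => h i (by omega)
  | succ M ih =>
    obtain ⟨d, rfl⟩ := Nat.exists_eq_add_of_le hM
    rw [Finset.sum_range_succ, ih (by omega), wellPoisedTerm_sub_succ B D M d h]
    ring

theorem wellPoisedTerm_last (B D : ℂ) (N : ℕ)
    (h : ∀ i ≤ 2 * (N + 1), B + D - 1 + (i : ℂ) ≠ 0) :
    wellPoisedTerm B D (N + 1) (N + 1) = wellPoisedCompanion B D N N := by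
  have e1 : B + D - 1 + ((N + 1 : ℕ) : ℂ) = B + D + N := by push_cast; ring
  have h1 : B + D + (N : ℂ) + ((N + 1 : ℕ) : ℂ) ≠ 0 := by
    convert h (2 * (N + 1)) le_rfl using 1; push_cast; ring
  have hp : poch (B + D + N) (N + 1) ≠ 0 := poch_ne_zero fun i hi => by
    convert h (N + 1 + i) (by omega) using 1; push_cast; ring
  simp only [wellPoisedTerm, wellPoisedCompanion, Nat.choose_self, Nat.sub_self, poch_zero, e1,
    poch_succ (B + D + N) (N + 1)]
  field_simp
  push_cast
  ring

/-- The terminating very-well-poised `₄F₃(-1)` summation. -/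
theorem sum_wellPoisedTerm (B D : ℂ) (N : ℕ)
    (h : ∀ i ≤ 2 * N, B + D - 1 + (i : ℂ) ≠ 0) :
    ∑ m ∈ Finset.range (N + 1), wellPoisedTerm B D N m = 1 := by
  induction N with
  | zero =>
    have h0 : B + D - 1 ≠ 0 := by simpa using h 0 le_rfl
    simp [wellPoisedTerm, poch, h0]
  | succ N ih =>
    have hs := sum_wellPoisedTerm_sub B D N N le_rfl h
    rw [Finset.sum_sub_distrib, ih fun i hi => h i (by omega)] at hs
    rw [Finset.sum_range_succ, wellPoisedTerm_last B D N h]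
    linear_combination hs

/-- Each term of the double sum is a summand of a very-well-poised series with shifted
parameters. -/
theorem connection_term_eq (a E L x : ℂ) (j m d : ℕ) (hE : poch E j ≠ 0)
    (h : ∀ i ≤ 2 * (j + m + d), 2 * a - 1 + (i : ℂ) ≠ 0) :
    ((1 - 2 * a - 2 * ((j + m : ℕ) : ℂ)) / (1 - 2 * a))
        * ((poch (-((j + m + d : ℕ) : ℂ)) (j + m) * poch (2 * a - 1) (j + m)) /
            (((j + m).factorial : ℂ) * poch (2 * a + (j + m + d : ℕ)) (j + m)))
        * ((poch (-((j + m : ℕ) : ℂ)) j * poch L j * poch (((j + m : ℕ) : ℂ) + 2 * a - 1) j) /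
            (poch E j * poch (-((j + m + d : ℕ) : ℂ)) j * (j.factorial : ℂ)))
        * aFun a (j + m + d) (j + m) x =
      (-1) ^ (j + m + d) * poch (2 * a) (j + m + d) *
        (poch L j * poch (x + a) j / (poch E j * (j.factorial : ℂ))) *
        wellPoisedTerm (x + a + j) (a - x + j) (m + d) m := by
  have hA : 1 - 2 * a ≠ 0 := fun h0 => h 0 (by omega) (by push_cast; linear_combination -h0)
  have f (n : ℕ) : ((n.factorial : ℕ) : ℂ) ≠ 0 := Nat.cast_ne_zero.mpr n.factorial_ne_zero
  have p1 : poch (-((j + m + d : ℕ) : ℂ)) (j + m) =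
      (-1) ^ (j + m) * ((j + m + d).factorial : ℂ) / (d.factorial : ℂ) := by
    rw [eq_div_iff (f d), show j + m + d = d + (j + m) by omega, poch_neg_natCast]
  have p2 : poch (-((j + m : ℕ) : ℂ)) j =
      (-1) ^ j * ((j + m).factorial : ℂ) / (m.factorial : ℂ) := by
    rw [eq_div_iff (f m), add_comm j m, poch_neg_natCast]
  have p3 : poch (-((j + m + d : ℕ) : ℂ)) j =
      (-1) ^ j * ((j + m + d).factorial : ℂ) / ((m + d).factorial : ℂ) := by
    rw [eq_div_iff (f _), show j + m + d = (m + d) + j by omega, poch_neg_natCast]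
  have p4 : ((m + d).choose m : ℂ) = (m + d).factorial / (m.factorial * d.factorial) := by
    rw [Nat.cast_add_choose]
  have hq : poch (2 * a + (j + m + d : ℕ)) (j + m) ≠ 0 := poch_ne_zero fun i hi => by
    convert h (j + m + d + 1 + i) (by omega) using 1; push_cast; ring
  have hr : poch (2 * a - 1 + (j + m + j : ℕ)) (m + d + 1) ≠ 0 := poch_ne_zero fun i hi => by
    convert h (j + m + j + i) (by omega) using 1; push_cast; ring
  have p5 : poch (2 * a - 1) (j + m) * poch (((j + m : ℕ) : ℂ) + 2 * a - 1) j *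
      poch (2 * a - 1 + (j + m + j : ℕ)) (m + d + 1) =
      (2 * a - 1) * poch (2 * a) (j + m + d) * poch (2 * a + (j + m + d : ℕ)) (j + m) := by
    rw [show ((j + m : ℕ) : ℂ) + 2 * a - 1 = 2 * a - 1 + (j + m : ℕ) by ring, ← poch_add,
      ← poch_add, mul_assoc, ← poch_add, show 2 * a = 2 * a - 1 + 1 by ring, add_sub_cancel_right,
      ← poch_succ']
    congr 1
    omega
  have p6 : poch (x + 1 - a - (j + m + d : ℕ)) d = (-1) ^ d * poch (a - x + j + m) d := by
    rw [poch_reflect]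
    congr 2
    push_cast
    ring
  have e1 : x + a + j + (a - x + j) - 1 + (m : ℂ) = 2 * a - 1 + (j + m + j : ℕ) := by
    push_cast; ring
  have s1 : j + m + d - (j + m) = d := by omega
  have s2 : m + d - m = d := by omega
  rw [aFun, wellPoisedTerm, s1, s2, p1, p2, p3, p4, p6, e1, poch_add (x + a) j m]
  set P1 := poch (2 * a - 1) (j + m)
  set P2 := poch (((j + m : ℕ) : ℂ) + 2 * a - 1) j
  set R := poch (2 * a - 1 + (j + m + j : ℕ)) (m + d + 1)
  set Q := poch (2 * a + (j + m + d : ℕ)) (j + m)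
  set T := poch (2 * a) (j + m + d)
  have p7 : P1 * P2 / Q = (2 * a - 1) * T / R := by
    rw [div_eq_div_iff hq hr, p5]
  have f1 := f d
  have f2 := f m
  have f3 := f (m + d)
  have f4 := f (j + m)
  have f5 := f (j + m + d)
  have f6 := f j
  trans (P1 * P2 / Q) * ((1 - 2 * a - 2 * ((j + m : ℕ) : ℂ)) / (1 - 2 * a) * (-1) ^ (j + m + d) *
    ((m + d).factorial / (m.factorial * d.factorial)) * poch L j / (poch E j * (j.factorial : ℂ)) *
    (poch (x + a) j * poch (x + a + j) m * poch (a - x + j + m) d))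
  · rw [pow_add _ (j + m) d]
    field_simp
  · rw [p7]
    field_simp
    push_cast
    ring

theorem poch_mul_poch_neg_div (z : ℂ) (j d : ℕ) (h : poch (1 - z - (j + d : ℕ)) j ≠ 0) :
    poch z (j + d) * (poch (-((j + d : ℕ) : ℂ)) j /
      (poch (1 - z - (j + d : ℕ)) j * (j.factorial : ℂ))) =
      ((j + d).choose j : ℂ) * poch z d := by
  have f (n : ℕ) : ((n.factorial : ℕ) : ℂ) ≠ 0 := Nat.cast_ne_zero.mpr n.factorial_ne_zero
  have f1 := f d
  have f2 := f j
  have p1 : poch (-((j + d : ℕ) : ℂ)) j = (-1) ^ j * ((j + d).factorial : ℂ) / d.factorial := by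
    rw [eq_div_iff (f d), add_comm j d, poch_neg_natCast]
  have p2 : poch (z + d) j = (-1) ^ j * poch (1 - z - (j + d : ℕ)) j := by
    rw [poch_reflect]
    congr 2
    push_cast
    ring
  have p3 : poch z (j + d) = poch z d * poch (z + d) j := by rw [add_comm, poch_add]
  have hs : ((-1 : ℂ)) ^ j * (-1) ^ j = 1 := by rw [← mul_pow]; norm_num
  rw [p3, p2, p1, Nat.cast_add_choose]
  field_simp
  linear_combination poch z d * ((j + d).factorial : ℂ) * hs

theorem sum_poch_chuVandermonde (z b : ℂ) (n N : ℕ) (hn : n ≤ N)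
    (h : ∀ j ≤ n, poch (1 - z - n) j ≠ 0) :
    poch z n * ∑ j ∈ Finset.range (N + 1),
      poch (-(n : ℂ)) j * poch b j / (poch (1 - z - n) j * (j.factorial : ℂ)) =
      poch (b + z) n := by
  rw [← sum_choose_mul_poch_mul_poch b z n, Finset.mul_sum]
  symm
  refine Finset.sum_subset_zero_on_sdiff (Finset.range_mono (by omega)) (fun j hj => ?_)
    fun j hj => ?_
  · have hj' : n < j := by
      have := (Finset.mem_sdiff.mp hj).2
      rw [Finset.mem_range] at this
      omega
    have : poch (-(n : ℂ)) j = 0 :=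
      Finset.prod_eq_zero (Finset.mem_range.mpr hj') (by ring)
    simp [this]
  · have hj' : j ≤ n := Nat.lt_succ_iff.mp (Finset.mem_range.mp hj)
    obtain ⟨d, rfl⟩ := Nat.exists_eq_add_of_le hj'
    have := poch_mul_poch_neg_div z j d (h j hj')
    rw [Nat.add_sub_cancel_left]
    linear_combination -poch b j * this

/-- Connection formula expanding `bₗ` over the basis `aₖ` with Hahn rational coefficients:
`bₗ = (-1)^N ((c-a)ₗ / (2a)_N)
       Σ_{k=0}^{N} ((1-2a-2k)/(1-2a)) ((-N)ₖ (2a-1)ₖ / (k! (2a+N)ₖ)) Uₖ(ℓ; a, c-1, N) aₖ`. -/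
theorem b_in_terms_of_a (a c : ℂ) (N : ℕ)
    (h1 : ∀ l ≤ N, ∀ i ≤ N - 1, a - c + 1 - (l : ℂ) + (i : ℂ) ≠ 0)
    (h2 : ∀ i ≤ N - 1, 2 * a + (i : ℂ) ≠ 0)
    (h3 : ∀ i ≤ N - 1, 2 * a + (N : ℂ) + (i : ℂ) ≠ 0)
    (h4 : 2 * a ≠ 1)
    (l : ℕ) (hl : l ≤ N) (x : ℂ) :
    bFun c l x =
      (-1 : ℂ) ^ N * (poch (c - a) l / poch (2 * a) N) *
        ∑ k ∈ Finset.range (N + 1),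
          ((1 - 2 * a - 2 * (k : ℂ)) / (1 - 2 * a))
            * ((poch (-(N : ℂ)) k * poch (2 * a - 1) k) /
                ((Nat.factorial k : ℂ) * poch (2 * a + N) k))
            * hahnU a (c - 1) N k (l : ℂ) * aFun a N k x := by
  have hA : ∀ i ≤ 2 * N, 2 * a - 1 + (i : ℂ) ≠ 0 := by
    intro i hi
    rcases Nat.eq_zero_or_pos i with rfl | hi0
    · intro h0
      exact h4 (by push_cast at h0; linear_combination h0)
    · rcases Nat.lt_or_ge N i with hiN | hiN
      · obtain ⟨e, rfl⟩ := Nat.exists_eq_add_of_lt hiN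
        convert h3 e (by omega) using 1
        push_cast; ring
      · obtain ⟨e, rfl⟩ := Nat.exists_eq_add_of_lt hi0
        convert h2 e (by omega) using 1
        push_cast; ring
  have hE : ∀ j ≤ N, poch (a - (c - 1) - l) j ≠ 0 := fun j hj => poch_ne_zero fun i hi => by
    convert h1 l hl i (by omega) using 1; ring
  have hT : poch (2 * a) N ≠ 0 := poch_ne_zero fun i hi => h2 i (by omega)
  have hE' : a - (c - 1) - l = 1 - (c - a) - (l : ℂ) := by ring
  have hV := sum_poch_chuVandermonde (c - a) (x + a) l N hl fun j hj => by
    rw [← hE']; exact hE j (hj.trans hl)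
  rw [← hE', show x + a + (c - a) = x + c by ring] at hV
  set E := a - (c - 1) - (l : ℂ)
  have hsum : ∑ k ∈ Finset.range (N + 1),
          ((1 - 2 * a - 2 * (k : ℂ)) / (1 - 2 * a))
            * ((poch (-(N : ℂ)) k * poch (2 * a - 1) k) /
                ((Nat.factorial k : ℂ) * poch (2 * a + N) k))
            * hahnU a (c - 1) N k (l : ℂ) * aFun a N k x =
      ∑ j ∈ Finset.range (N + 1), (-1) ^ N * poch (2 * a) N *
        (poch (-(l : ℂ)) j * poch (x + a) j / (poch E j * (j.factorial : ℂ))) := by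
    let F : ℕ → ℕ → ℂ := fun j m => (-1) ^ N * poch (2 * a) N *
        (poch (-(l : ℂ)) j * poch (x + a) j / (poch E j * (j.factorial : ℂ))) *
        wellPoisedTerm (x + a + j) (a - x + j) (N - j) m
    trans ∑ k ∈ Finset.range (N + 1), ∑ j ∈ Finset.range (k + 1), F j (k - j)
    · refine Finset.sum_congr rfl fun k hk => ?_
      rw [hahnU, Finset.mul_sum, Finset.sum_mul]
      refine Finset.sum_congr rfl fun j hj => ?_
      have hk' : k ≤ N := Nat.lt_succ_iff.mp (Finset.mem_range.mp hk)
      have hj' : j ≤ k := Nat.lt_succ_iff.mp (Finset.mem_range.mp hj)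
      have hEj := hE j (hj'.trans hk')
      obtain ⟨m, rfl⟩ := Nat.exists_eq_add_of_le hj'
      obtain ⟨d, rfl⟩ := Nat.exists_eq_add_of_le hk'
      have := connection_term_eq a E (-(l : ℂ)) x j m d hEj hA
      simp only [F, Nat.add_sub_cancel_left, show j + m + d - j = m + d by omega]
      exact this
    · rw [Finset.sum_range_diag_flip]
      refine Finset.sum_congr rfl fun j hj => ?_
      have hj' : j ≤ N := Nat.lt_succ_iff.mp (Finset.mem_range.mp hj)
      simp only [F]
      rw [← Finset.mul_sum, show N + 1 - j = N - j + 1 by omega, sum_wellPoisedTerm, mul_one]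
      intro i hi
      convert hA (2 * j + i) (by omega) using 1
      push_cast; ring
  have hs : ((-1 : ℂ)) ^ N * (-1) ^ N = 1 := by rw [← mul_pow]; norm_num
  rw [hsum, ← Finset.mul_sum, bFun, ← hV]
  set S := ∑ j ∈ Finset.range (N + 1),
    poch (-(l : ℂ)) j * poch (x + a) j / (poch E j * (j.factorial : ℂ))
  trans poch (c - a) l * S * ((-1) ^ N * (-1) ^ N) * (poch (2 * a) N / poch (2 * a) N)
  · rw [hs, div_self hT, mul_one, mul_one]
  · ring
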